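/- Let m₁ ≥ 0 and m₂ ≥ −3 be integers and set m := −2m₁ + m₂ + 2. Let n and N be integers with N > n and m + n ≥ 1, and for each ℓ = n+1, …, N let P_ℓ : ℝ² → ℝ be a homogeneous polynomial function of degree 3ℓ + m₂. Then the function τ : ℝ² → ℝ defined by τ(z) = ∑_{ℓ=n+1}^{N} R(z)^{−2(ℓ+m₁)+1} P_ℓ(z) for z ≠ (0,0) and τ(0,0) = 0 is (m+n−1) times continuously differentiable on ℝ², and every partial derivative of τ of order at most m+n−1 vanishes at the origin. -/

import Mathlib

lemma hom_bound {F : Type} [NormedAddCommGroup F] [NormedSpace ℝ F] (d : ℕ)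
    (f : ℝ × ℝ → F) (hf : ContinuousOn f {0}ᶜ)
    (h0 : f 0 = 0) (hh : ∀ t : ℝ, 0 < t → ∀ z, z ≠ 0 → f (t • z) = t ^ d • f z) :
    ∃ C : ℝ, ∀ z, ‖f z‖ ≤ C * ‖z‖ ^ d := by
  have hc : IsCompact (Metric.sphere (0 : ℝ × ℝ) 1) := isCompact_sphere _ _
  obtain ⟨C, hC⟩ := hc.exists_bound_of_continuousOn (f := f) (hf.mono (by
    intro z hz h
    simp only [Set.mem_singleton_iff] at h
    subst h
    simp at hz))
  refine ⟨max C 0, fun z => ?_⟩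
  by_cases hz : z = 0
  · subst hz
    rw [h0, norm_zero]
    positivity
  have hz' : 0 < ‖z‖ := norm_pos_iff.mpr hz
  have h1 : f z = ‖z‖ ^ d • f (‖z‖⁻¹ • z) := by
    rw [← hh _ hz' _ (smul_ne_zero (inv_ne_zero hz'.ne') hz), smul_smul,
      mul_inv_cancel₀ hz'.ne', one_smul]
  have h2 := hC (‖z‖⁻¹ • z) (by
    simp [norm_smul, hz'.ne'])
  rw [h1, norm_smul, norm_pow, norm_norm, mul_comm]
  gcongr
  exact h2.trans (le_max_left _ _)

lemma hom_contDiff (K : ℕ) : ∀ {F : Type} [NormedAddCommGroup F] [NormedSpace ℝ F] (d : ℕ)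
    (_ : K + 1 ≤ d) (f : ℝ × ℝ → F) (_ : ∀ z, z ≠ 0 → ContDiffAt ℝ (⊤ : ℕ∞) f z)
    (_ : f 0 = 0) (_ : ∀ t : ℝ, 0 < t → ∀ z, z ≠ 0 → f (t • z) = t ^ d • f z),
    ContDiff ℝ K f ∧ ∀ k ≤ K, iteratedFDeriv ℝ k f 0 = 0 := by
  induction K with
  | zero =>
    intro F _ _ d hd f hf h0 hh
    obtain ⟨C, hC⟩ := hom_bound d f
      (fun z hz => (hf z hz).continuousAt.continuousWithinAt) h0 hh
    constructor
    · rw [Nat.cast_zero, contDiff_zero, continuous_iff_continuousAt]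
      intro z
      by_cases hz : z = 0
      · subst hz
        rw [ContinuousAt, h0]
        apply squeeze_zero_norm hC
        have : Continuous (fun z : ℝ × ℝ => C * ‖z‖ ^ d) := by fun_prop
        have h := this.tendsto 0
        simpa [show d ≠ 0 by omega] using h
      · exact (hf z hz).continuousAt
    · intro k hk
      obtain rfl : k = 0 := by omega
      ext v
      simp [h0]
  | succ K ih =>
    intro F _ _ d hd f hf h0 hh
    obtain ⟨C, hC⟩ := hom_bound d f
      (fun z hz => (hf z hz).continuousAt.continuousWithinAt) h0 hh
    have hd0 : HasFDerivAt f (0 : ℝ × ℝ →L[ℝ] F) 0 := by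
      rw [hasFDerivAt_iff_tendsto]
      simp only [h0, sub_zero, ContinuousLinearMap.zero_apply]
      have hle : ∀ z : ℝ × ℝ, ‖‖z‖⁻¹ * ‖f z‖‖ ≤ C * ‖z‖ ^ (d - 1) := by
        intro z
        by_cases hz : z = 0
        · subst hz
          simp [show d - 1 ≠ 0 by omega]
        have hz' : 0 < ‖z‖ := norm_pos_iff.mpr hz
        rw [Real.norm_of_nonneg (by positivity), inv_mul_le_iff₀ hz']
        refine (hC z).trans (le_of_eq ?_)
        obtain ⟨e, rfl⟩ : ∃ e, d = e + 1 := ⟨d - 1, by omega⟩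
        simp only [Nat.add_sub_cancel]
        ring
      apply squeeze_zero_norm hle
      have : Continuous (fun z : ℝ × ℝ => C * ‖z‖ ^ (d - 1)) := by fun_prop
      have h := this.tendsto 0
      simpa [show d - 1 ≠ 0 by omega] using h
    have hdiff : Differentiable ℝ f := by
      intro z
      by_cases hz : z = 0
      · subst hz
        exact hd0.differentiableAt
      · exact (hf z hz).differentiableAt (by simp)
    obtain ⟨h1, h2⟩ := ih (d - 1) (by omega) (fderiv ℝ f)
      (fun z hz => (hf z hz).fderiv_right (by simp)) hd0.fderiv (by
        intro t ht z hz
        have e1 : HasFDerivAt (fun w : ℝ × ℝ => f (t • w))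
            ((fderiv ℝ f (t • z)).comp (t • ContinuousLinearMap.id ℝ (ℝ × ℝ))) z :=
          HasFDerivAt.comp z (hdiff (t • z)).hasFDerivAt
            ((hasFDerivAt_id z).const_smul t)
        have e2 : HasFDerivAt (fun w : ℝ × ℝ => t ^ d • f w) (t ^ d • fderiv ℝ f z) z :=
          (hdiff z).hasFDerivAt.const_smul _
        have e3 := (e2.congr_of_eventuallyEq (by
          filter_upwards [isOpen_ne.mem_nhds hz] with w hw using hh t ht w hw)).unique e1
        obtain ⟨e, rfl⟩ : ∃ e, d = e + 1 := ⟨d - 1, by omega⟩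
        simp only [Nat.add_sub_cancel]
        refine ContinuousLinearMap.ext fun v => ?_
        have e4 := congrArg (fun L => t⁻¹ • L v) e3
        simp only [ContinuousLinearMap.smul_apply, ContinuousLinearMap.comp_apply,
          ContinuousLinearMap.id_apply, map_smul, smul_smul, inv_mul_cancel₀ ht.ne',
          one_smul] at e4
        rw [← e4, ContinuousLinearMap.smul_apply]
        congr 1
        field_simp
        ring)
    constructor
    · rw [Nat.cast_succ, contDiff_succ_iff_fderiv]
      exact ⟨hdiff, by simp, h1⟩
    · intro k hk
      cases k with
      | zero => ext v; simp [h0]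
      | succ k =>
        rw [← norm_eq_zero, ← norm_iteratedFDeriv_fderiv, h2 k (by omega), norm_zero]

lemma quad_pos (a b c : ℝ) (ha : 0 < a) (hd : 0 < 4 * a * c - b ^ 2) (z : ℝ × ℝ) (hz : z ≠ 0) :
    0 < a * z.1 ^ 2 + b * z.1 * z.2 + c * z.2 ^ 2 := by
  have h : 0 < 4 * a * (a * z.1 ^ 2 + b * z.1 * z.2 + c * z.2 ^ 2) := by
    have e : 4 * a * (a * z.1 ^ 2 + b * z.1 * z.2 + c * z.2 ^ 2)
      = (2 * a * z.1 + b * z.2) ^ 2 + (4 * a * c - b ^ 2) * z.2 ^ 2 := by ring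
    rw [e]
    by_cases h2 : z.2 = 0
    · have h1 : z.1 ≠ 0 := fun h1 => hz (Prod.ext h1 h2)
      rw [h2]
      have : 0 < (2 * a * z.1) ^ 2 := by positivity
      simpa using this
    · have : 0 < (4 * a * c - b ^ 2) * z.2 ^ 2 := by positivity
      positivity
  exact pos_of_mul_pos_right h (by positivity)


/-- singularity subtraction regularity: with `m = −2m₁ + m₂ + 2`
and `m + n ≥ 1`, the tail
`τ(z) = ∑_{ℓ=n+1}^{N} R(z)^(−2(ℓ+m₁)+1) P_ℓ(z)` (with `τ(0) = 0`), where each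
`P_ℓ` is homogeneous of degree `3ℓ + m₂`, is `C^(m+n−1)` on `ℝ²` and all its
derivatives of order at most `m + n − 1` vanish at the origin. -/
theorem stmt_8 (a b c : ℝ) (ha : 0 < a) (hc : 0 < c) (hd : 0 < 4 * a * c - b ^ 2)
    (m₁ : ℕ) (m₂ : ℤ) (hm₂ : -3 ≤ m₂)
    (m : ℤ) (hm_def : m = -2 * (m₁ : ℤ) + m₂ + 2)
    (n N : ℕ) (hnN : n < N) (hmn : 1 ≤ m + (n : ℤ))
    (P : ℕ → ℝ × ℝ → ℝ)
    (hhom : ∀ ℓ ∈ Finset.Icc (n + 1) N, ∃ cα : ℕ → ℝ, ∀ z : ℝ × ℝ,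
      P ℓ z = ∑ j ∈ Finset.range ((3 * (ℓ : ℤ) + m₂).toNat + 1),
        cα j * z.1 ^ j * z.2 ^ ((3 * (ℓ : ℤ) + m₂).toNat - j))
    (τ : ℝ × ℝ → ℝ)
    (hτ0 : τ 0 = 0)
    (hτ : ∀ z : ℝ × ℝ, z ≠ 0 →
      τ z = ∑ ℓ ∈ Finset.Icc (n + 1) N,
        (a * z.1 ^ 2 + b * z.1 * z.2 + c * z.2 ^ 2)
            ^ ((-2 * ((ℓ : ℝ) + (m₁ : ℝ)) + 1) / 2) * P ℓ z) :
    ContDiff ℝ ((m + (n : ℤ) - 1).toNat) τ ∧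
      ∀ k ≤ (m + (n : ℤ) - 1).toNat, iteratedFDeriv ℝ k τ 0 = 0 := by
  set K := (m + (n : ℤ) - 1).toNat with hK
  have key : ∀ ℓ ∈ Finset.Icc (n + 1) N,
      ContDiff ℝ K (fun z : ℝ × ℝ => (a * z.1 ^ 2 + b * z.1 * z.2 + c * z.2 ^ 2)
            ^ ((-2 * ((ℓ : ℝ) + (m₁ : ℝ)) + 1) / 2) * P ℓ z) ∧
      ∀ k ≤ K, iteratedFDeriv ℝ k (fun z : ℝ × ℝ =>
        (a * z.1 ^ 2 + b * z.1 * z.2 + c * z.2 ^ 2)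
            ^ ((-2 * ((ℓ : ℝ) + (m₁ : ℝ)) + 1) / 2) * P ℓ z) 0 = 0 := by
    intro ℓ hℓ
    obtain ⟨cα, hP⟩ := hhom ℓ hℓ
    rw [Finset.mem_Icc] at hℓ
    have hPf : P ℓ = fun z : ℝ × ℝ => ∑ j ∈ Finset.range ((3 * (ℓ : ℤ) + m₂).toNat + 1),
        cα j * z.1 ^ j * z.2 ^ ((3 * (ℓ : ℤ) + m₂).toNat - j) := funext hP
    obtain ⟨D, hD⟩ : ∃ D : ℕ, D = (3 * (ℓ : ℤ) + m₂).toNat := ⟨_, rfl⟩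
    rw [← hD] at hPf
    have hDz : (D : ℤ) = 3 * (ℓ : ℤ) + m₂ := by omega
    obtain ⟨d, hd'⟩ : ∃ d : ℕ, d = ((ℓ : ℤ) + m - 1).toNat := ⟨_, rfl⟩
    have hdz : (d : ℤ) = D + (-2 * ((ℓ : ℤ) + m₁) + 1) := by omega
    have hdr : (d : ℝ) = D + (-2 * ((ℓ : ℝ) + m₁) + 1) := by exact_mod_cast hdz
    have hne : ((-2 * ((ℓ : ℝ) + (m₁ : ℝ)) + 1) / 2) ≠ 0 := by
      intro h
      have h3 : ((-2 * ((ℓ : ℤ) + (m₁ : ℤ)) + 1 : ℤ) : ℝ) = 0 := by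
        push_cast
        linarith
      have h4 : (-2 * ((ℓ : ℤ) + (m₁ : ℤ)) + 1 : ℤ) = 0 := by exact_mod_cast h3
      omega
    apply hom_contDiff K d (by omega)
    · intro z hz
      have hq := quad_pos a b c ha hd z hz
      apply ContDiffAt.mul
      · apply ContDiffAt.rpow_const_of_ne
        · fun_prop
        · exact hq.ne'
      · rw [hPf]
        fun_prop
    · have h0 : a * (0 : ℝ × ℝ).1 ^ 2 + b * (0 : ℝ × ℝ).1 * (0 : ℝ × ℝ).2
          + c * (0 : ℝ × ℝ).2 ^ 2 = 0 := by simp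
      rw [h0, Real.zero_rpow hne, zero_mul]
    · intro t ht z hz
      have hq := quad_pos a b c ha hd z hz
      have e1 : a * (t • z).1 ^ 2 + b * (t • z).1 * (t • z).2 + c * (t • z).2 ^ 2
          = t ^ 2 * (a * z.1 ^ 2 + b * z.1 * z.2 + c * z.2 ^ 2) := by
        simp only [Prod.smul_fst, Prod.smul_snd, smul_eq_mul]
        ring
      have e2 : P ℓ (t • z) = t ^ D * P ℓ z := by
        rw [hPf]
        simp only [Prod.smul_fst, Prod.smul_snd, smul_eq_mul]
        rw [Finset.mul_sum]
        apply Finset.sum_congr rfl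
        intro j hj
        rw [Finset.mem_range] at hj
        obtain ⟨i, rfl⟩ : ∃ i, D = j + i := ⟨D - j, by omega⟩
        simp only [Nat.add_sub_cancel_left]
        ring
      have e3 : (t ^ 2) ^ ((-2 * ((ℓ : ℝ) + (m₁ : ℝ)) + 1) / 2) * t ^ D = t ^ d := by
        rw [← Real.rpow_natCast t d, ← Real.rpow_natCast t D, ← Real.rpow_natCast t 2,
          ← Real.rpow_mul ht.le, ← Real.rpow_add ht, hdr]
        congr 1
        push_cast
        ring
      rw [e1, e2, Real.mul_rpow (by positivity) hq.le, smul_eq_mul, ← e3]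
      ring
  have hτf : τ = fun z => ∑ ℓ ∈ Finset.Icc (n + 1) N,
        (a * z.1 ^ 2 + b * z.1 * z.2 + c * z.2 ^ 2)
            ^ ((-2 * ((ℓ : ℝ) + (m₁ : ℝ)) + 1) / 2) * P ℓ z := by
    funext z
    by_cases hz : z = 0
    · subst hz
      rw [hτ0, Finset.sum_eq_zero]
      intro ℓ hℓ
      have h := (key ℓ hℓ).2 0 (Nat.zero_le _)
      have h' := congrArg (fun L => L (fun _ => 0)) h
      simpa only [iteratedFDeriv_zero_apply, ContinuousMultilinearMap.zero_apply] using h'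
    · exact hτ z hz
  rw [hτf]
  refine ⟨ContDiff.sum fun ℓ hℓ => (key ℓ hℓ).1, fun k hk => ?_⟩
  rw [iteratedFDeriv_fun_sum_apply
    (fun ℓ hℓ => ((key ℓ hℓ).1.of_le (by exact_mod_cast hk)).contDiffAt)]
  exact Finset.sum_eq_zero fun ℓ hℓ => (key ℓ hℓ).2 k hk
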